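/- There exists ε₀ > 0 such that for every ε ∈ (0, ε₀) there exists a constant c > 0, depending on ε but not on n, such that Var[L_n] ≥ c·n for all n ≥ 1. -/

import Mathlib

open scoped BigOperators
open Classical

noncomputable section

/-- Length of a longest common subsequence of two boolean lists. -/
def lcsLen (x y : List Bool) : ℕ :=
  sSup {k : ℕ | ∃ z : List Bool, z.length = k ∧ z.Sublist x ∧ z.Sublist y}

/-- Bernoulli(ε) product weight of a binary string. -/
def wt (ε : ℝ) {n : ℕ} (x : Fin n → Bool) : ℝ :=
  ∏ i, if x i then ε else 1 - ε

/-- Expectation of a function of two independent i.i.d. Bernoulli(ε) strings of length n. -/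
def expec (ε : ℝ) (n : ℕ) (f : (Fin n → Bool) → (Fin n → Bool) → ℝ) : ℝ :=
  ∑ x : Fin n → Bool, ∑ y : Fin n → Bool, wt ε x * wt ε y * f x y

/-- LCS length of two binary strings of length n. -/
def Lcs {n : ℕ} (x y : Fin n → Bool) : ℕ := lcsLen (List.ofFn x) (List.ofFn y)

/-- Variance of the LCS length `L_n` of two independent i.i.d. Bernoulli(ε) strings. -/
def varL (ε : ℝ) (n : ℕ) : ℝ :=
  expec ε n (fun x y => (Lcs x y : ℝ) ^ 2) - (expec ε n fun x y => (Lcs x y : ℝ)) ^ 2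

/-- Expectation over an i.i.d. Bernoulli(ε) list of length `n`, recursively. -/
def Ex (ε : ℝ) : ℕ → (List Bool → ℝ) → ℝ
  | 0, h => h []
  | n + 1, h => (1 - ε) * Ex ε n (fun l => h (false :: l)) + ε * Ex ε n (fun l => h (true :: l))

/-- Expectation over two independent lists. -/
def E2 (ε : ℝ) (a b : ℕ) (F : List Bool → List Bool → ℝ) : ℝ :=
  Ex ε a (fun x => Ex ε b (fun y => F x y))

theorem sum_eq_Ex (ε : ℝ) : ∀ (n : ℕ) (h : List Bool → ℝ),
    ∑ x : Fin n → Bool, wt ε x * h (List.ofFn x) = Ex ε n h := by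
  intro n
  induction n with
  | zero => intro h; simp [wt, Ex]
  | succ n ih =>
    intro h
    rw [← (Fin.consEquiv (fun _ : Fin (n+1) => Bool)).sum_comp, Fintype.sum_prod_type]
    simp only [Fin.consEquiv, Equiv.coe_fn_mk, Fintype.sum_bool, wt, Fin.prod_univ_succ,
      Fin.cons_zero, Fin.cons_succ, List.ofFn_succ, Ex]
    rw [← ih, ← ih, Finset.mul_sum, Finset.mul_sum, add_comm]
    simp [wt, mul_assoc]

theorem expec_eq_E2 (ε : ℝ) (n : ℕ) (F : List Bool → List Bool → ℝ) :
    expec ε n (fun x y => F (List.ofFn x) (List.ofFn y)) = E2 ε n n F := by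
  unfold expec E2
  rw [← sum_eq_Ex]
  refine Finset.sum_congr rfl fun x _ => ?_
  rw [← sum_eq_Ex, Finset.mul_sum]
  simp only [mul_assoc]

theorem Ex_add (ε : ℝ) : ∀ (n : ℕ) (f g : List Bool → ℝ),
    Ex ε n (fun l => f l + g l) = Ex ε n f + Ex ε n g := by
  intro n
  induction n with
  | zero => intro f g; simp [Ex]
  | succ n ih => intro f g; simp only [Ex, ih]; ring

theorem Ex_mul (ε : ℝ) : ∀ (n : ℕ) (c : ℝ) (f : List Bool → ℝ),
    Ex ε n (fun l => c * f l) = c * Ex ε n f := by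
  intro n
  induction n with
  | zero => intro f g; simp [Ex]
  | succ n ih => intro f g; simp only [Ex, ih]; ring

theorem Ex_const (ε : ℝ) : ∀ (n : ℕ) (c : ℝ), Ex ε n (fun _ => c) = c := by
  intro n
  induction n with
  | zero => intro c; simp [Ex]
  | succ n ih => intro c; simp only [Ex, ih]; ring

theorem Ex_mono (ε : ℝ) (h0 : 0 ≤ ε) (h1 : ε ≤ 1) : ∀ (n : ℕ) (f g : List Bool → ℝ),
    (∀ l, l.length = n → f l ≤ g l) → Ex ε n f ≤ Ex ε n g := by
  intro n
  induction n with
  | zero => intro f g h; simpa [Ex] using h [] rfl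
  | succ n ih =>
    intro f g h
    simp only [Ex]
    have h1' : 0 ≤ 1 - ε := by linarith
    exact add_le_add
      (mul_le_mul_of_nonneg_left (ih _ _ fun l hl => h _ (by simp [hl])) h1')
      (mul_le_mul_of_nonneg_left (ih _ _ fun l hl => h _ (by simp [hl])) h0)

theorem Ex_congr (ε : ℝ) : ∀ (n : ℕ) (f g : List Bool → ℝ),
    (∀ l, l.length = n → f l = g l) → Ex ε n f = Ex ε n g := by
  intro n
  induction n with
  | zero => intro f g h; simpa [Ex] using h [] rfl
  | succ n ih =>
    intro f g h
    simp only [Ex]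
    rw [ih _ (fun l => g (false :: l)) fun l hl => h _ (by simp [hl]),
      ih _ (fun l => g (true :: l)) fun l hl => h _ (by simp [hl])]

theorem Ex_sum (ε : ℝ) (n m : ℕ) (f : ℕ → List Bool → ℝ) :
    Ex ε n (fun l => ∑ i ∈ Finset.range m, f i l) = ∑ i ∈ Finset.range m, Ex ε n (f i) := by
  induction m with
  | zero => simp [Ex_const]
  | succ m ih => simp only [Finset.sum_range_succ, Ex_add, ih]

theorem Ex_swap (ε : ℝ) : ∀ (a b : ℕ) (F : List Bool → List Bool → ℝ),
    Ex ε a (fun x => Ex ε b (fun y => F x y)) = Ex ε b (fun y => Ex ε a (fun x => F x y)) := by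
  intro a
  induction a with
  | zero => intro b F; simp [Ex]
  | succ a ih =>
    intro b F
    simp only [Ex, ih, Ex_add, Ex_mul]

theorem E2_add (ε : ℝ) (a b : ℕ) (F G : List Bool → List Bool → ℝ) :
    E2 ε a b (fun x y => F x y + G x y) = E2 ε a b F + E2 ε a b G := by
  simp only [E2, Ex_add]

theorem E2_mul (ε : ℝ) (a b : ℕ) (c : ℝ) (F : List Bool → List Bool → ℝ) :
    E2 ε a b (fun x y => c * F x y) = c * E2 ε a b F := by
  simp only [E2, Ex_mul]

theorem E2_const (ε : ℝ) (a b : ℕ) (c : ℝ) : E2 ε a b (fun _ _ => c) = c := by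
  simp only [E2, Ex_const]

theorem E2_mono (ε : ℝ) (h0 : 0 ≤ ε) (h1 : ε ≤ 1) (a b : ℕ) (F G : List Bool → List Bool → ℝ)
    (h : ∀ x y, x.length = a → y.length = b → F x y ≤ G x y) : E2 ε a b F ≤ E2 ε a b G :=
  Ex_mono ε h0 h1 _ _ _ fun x hx => Ex_mono ε h0 h1 _ _ _ fun y hy => h x y hx hy

theorem E2_congr (ε : ℝ) (a b : ℕ) (F G : List Bool → List Bool → ℝ)
    (h : ∀ x y, x.length = a → y.length = b → F x y = G x y) : E2 ε a b F = E2 ε a b G :=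
  Ex_congr ε _ _ _ fun x hx => Ex_congr ε _ _ _ fun y hy => h x y hx hy

/-! ### LCS facts -/

theorem lcs_bdd (x y : List Bool) :
    BddAbove {k : ℕ | ∃ z : List Bool, z.length = k ∧ z.Sublist x ∧ z.Sublist y} := by
  refine ⟨x.length, ?_⟩
  rintro k ⟨z, rfl, hx, _⟩
  exact hx.length_le

theorem lcs_ex (x y : List Bool) :
    ∃ z : List Bool, z.length = lcsLen x y ∧ z.Sublist x ∧ z.Sublist y :=
  Nat.sSup_mem (s := {k : ℕ | ∃ z : List Bool, z.length = k ∧ z.Sublist x ∧ z.Sublist y})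
    ⟨0, [], rfl, List.nil_sublist _, List.nil_sublist _⟩ (lcs_bdd x y)

theorem le_lcs {x y z : List Bool} (hx : z.Sublist x) (hy : z.Sublist y) :
    z.length ≤ lcsLen x y :=
  le_csSup (lcs_bdd x y) ⟨z, rfl, hx, hy⟩

theorem lcs_comm (x y : List Bool) : lcsLen x y = lcsLen y x := by
  apply le_antisymm
  · obtain ⟨z, hz, hx, hy⟩ := lcs_ex x y
    rw [← hz]; exact le_lcs hy hx
  · obtain ⟨z, hz, hx, hy⟩ := lcs_ex y x
    rw [← hz]; exact le_lcs hy hx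

theorem lcs_mono {x y x' y' : List Bool} (hx : x.Sublist x') (hy : y.Sublist y') :
    lcsLen x y ≤ lcsLen x' y' := by
  obtain ⟨z, hz, h1, h2⟩ := lcs_ex x y
  rw [← hz]; exact le_lcs (h1.trans hx) (h2.trans hy)

theorem lcs_cons_le (c : Bool) (x y : List Bool) : lcsLen (c :: x) y ≤ lcsLen x y + 1 := by
  obtain ⟨z, hz, h1, h2⟩ := lcs_ex (c :: x) y
  rw [← hz]
  rcases List.sublist_cons_iff.1 h1 with h | ⟨r, rfl, h⟩
  · exact (le_lcs h h2).trans (Nat.le_succ _)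
  · simpa using le_lcs h ((List.sublist_cons_self _ _).trans h2)

theorem lcs_cons_le' (c : Bool) (x y : List Bool) : lcsLen x (c :: y) ≤ lcsLen x y + 1 := by
  rw [lcs_comm, lcs_comm x y]; exact lcs_cons_le c y x

theorem lcs_cons_cons (c : Bool) (x y : List Bool) :
    lcsLen x y + 1 ≤ lcsLen (c :: x) (c :: y) := by
  obtain ⟨z, hz, h1, h2⟩ := lcs_ex x y
  rw [← hz]
  simpa using le_lcs (h1.cons_cons c) (h2.cons_cons c)

/-- mean LCS -/
def mL (ε : ℝ) (a b : ℕ) : ℝ := E2 ε a b (fun x y => (lcsLen x y : ℝ))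

theorem mL_comm (ε : ℝ) (a b : ℕ) : mL ε a b = mL ε b a := by
  unfold mL E2
  rw [Ex_swap]
  simp only [lcs_comm]

theorem E2_succ_succ (ε : ℝ) (a b : ℕ) (F : List Bool → List Bool → ℝ) :
    E2 ε (a+1) (b+1) F =
      (1 - ε) * ((1 - ε) * E2 ε a b (fun x y => F (false :: x) (false :: y))
        + ε * E2 ε a b (fun x y => F (false :: x) (true :: y)))
      + ε * ((1 - ε) * E2 ε a b (fun x y => F (true :: x) (false :: y))
        + ε * E2 ε a b (fun x y => F (true :: x) (true :: y))) := by
  simp only [E2, Ex, Ex_add, Ex_mul]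

theorem mL_succ_succ (ε : ℝ) (h0 : 0 ≤ ε) (h1 : ε ≤ 1) (n : ℕ) :
    mL ε n n + (1 - 2 * ε) ≤ mL ε (n+1) (n+1) := by
  unfold mL
  rw [E2_succ_succ]
  set m := E2 ε n n (fun x y => (lcsLen x y : ℝ)) with hm
  have hd : ∀ c : Bool, m + 1 ≤ E2 ε n n (fun x y => (lcsLen (c :: x) (c :: y) : ℝ)) := by
    intro c
    have : m + 1 = E2 ε n n (fun x y => (lcsLen x y : ℝ) + 1) := by
      rw [E2_add, E2_const]
    rw [this]
    refine E2_mono ε h0 h1 _ _ _ _ fun x y _ _ => ?_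
    exact_mod_cast lcs_cons_cons c x y
  have ho : ∀ c d : Bool, m ≤ E2 ε n n (fun x y => (lcsLen (c :: x) (d :: y) : ℝ)) := by
    intro c d
    refine E2_mono ε h0 h1 _ _ _ _ fun x y _ _ => ?_
    exact_mod_cast lcs_mono (List.sublist_cons_self _ _) (List.sublist_cons_self _ _)
  have a1 := hd false
  have a2 := hd true
  have a3 := ho false true
  have a4 := ho true false
  have h1' : 0 ≤ 1 - ε := by linarith
  have b1 := mul_le_mul_of_nonneg_left a1 (mul_nonneg h1' h1')
  have b2 := mul_le_mul_of_nonneg_left a2 (mul_nonneg h0 h0)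
  have b3 := mul_le_mul_of_nonneg_left a3 (mul_nonneg h0 h1')
  have b4 := mul_le_mul_of_nonneg_left a4 (mul_nonneg h0 h1')
  nlinarith [sq_nonneg ε]

theorem mL_diag (ε : ℝ) (h0 : 0 ≤ ε) (h1 : ε ≤ 1) (n : ℕ) : (1 - 2 * ε) * n ≤ mL ε n n := by
  induction n with
  | zero => simp [mL, E2, Ex]
  | succ n ih =>
    have := mL_succ_succ ε h0 h1 n
    push_cast
    linarith

theorem mL_mono (ε : ℝ) (h0 : 0 ≤ ε) (h1 : ε ≤ 1) (n b : ℕ) : mL ε n b ≤ mL ε (n+1) b := by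
  have h : ∀ c : Bool, mL ε n b ≤ E2 ε n b (fun x y => (lcsLen (c :: x) y : ℝ)) := by
    intro c
    refine E2_mono ε h0 h1 _ _ _ _ fun x y _ _ => ?_
    exact_mod_cast lcs_mono (List.sublist_cons_self _ _) (List.Sublist.refl _)
  have e : mL ε (n+1) b = (1 - ε) * E2 ε n b (fun x y => (lcsLen (false :: x) y : ℝ))
      + ε * E2 ε n b (fun x y => (lcsLen (true :: x) y : ℝ)) := rfl
  have h1' : 0 ≤ 1 - ε := by linarith
  have b1 := mul_le_mul_of_nonneg_left (h false) h1'
  have b2 := mul_le_mul_of_nonneg_left (h true) h0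
  linarith

/-! ### number of ones -/

theorem Ex_count (ε : ℝ) (n : ℕ) : Ex ε n (fun l => (l.count true : ℝ)) = ε * n := by
  induction n with
  | zero => simp [Ex]
  | succ n ih =>
    simp only [Ex, List.count_cons]
    simp [Ex_add, Ex_const, ih]
    ring

theorem Ex_count_sq (ε : ℝ) (n : ℕ) :
    Ex ε n (fun l => (l.count true : ℝ) ^ 2) = (ε * n) ^ 2 + n * ε * (1 - ε) := by
  induction n with
  | zero => simp [Ex]
  | succ n ih =>
    simp only [Ex, List.count_cons]
    simp [ih, add_sq, Ex_add, Ex_const]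
    have : Ex ε n (fun l => 2 * (l.count true : ℝ)) = 2 * (ε * n) := by
      rw [Ex_mul, Ex_count]
    rw [this]
    ring

theorem Ex_erase (ε : ℝ) : ∀ (n i : ℕ) (h : List Bool → ℝ), i ≤ n →
    Ex ε (n+1) (fun x => if x.getD i false = true then h (x.eraseIdx i) else 0) = ε * Ex ε n h := by
  intro n
  induction n with
  | zero =>
    intro i h hi
    obtain rfl : i = 0 := by omega
    simp [Ex]
  | succ n ih =>
    intro i h hi
    cases i with
    | zero =>
      rw [Ex]
      simp [Ex_const]
    | succ i =>
      have h1 := ih i (fun l => h (false :: l)) (by omega)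
      have h2 := ih i (fun l => h (true :: l)) (by omega)
      rw [Ex]
      simp only [List.getD_cons_succ, List.eraseIdx_cons_succ]
      rw [h1, h2, Ex]
      ring

theorem count_eq_sum (x : List Bool) (c : ℝ) :
    ∑ i ∈ Finset.range x.length, (if x.getD i false = true then c else 0) = x.count true * c := by
  induction x with
  | nil => simp
  | cons a x ih =>
    rw [List.length_cons, Finset.sum_range_succ']
    simp only [List.getD_cons_succ, List.getD_cons_zero, ih]
    cases a <;> simp [List.count_cons]
    ring

/-- essential ones are among the matched ones -/
theorem ess_le {z x : List Bool} (h : z.Sublist x) :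
    ∑ i ∈ Finset.range x.length,
      (if x.getD i false = true ∧ ¬ z.Sublist (x.eraseIdx i) then (1:ℝ) else 0)
      ≤ z.count true := by
  induction h with
  | slnil => simp
  | @cons z x a h ih =>
    rw [List.length_cons, Finset.sum_range_succ']
    simp only [List.getD_cons_succ, List.getD_cons_zero, List.eraseIdx_cons_succ,
      List.eraseIdx_cons_zero, h, not_true, and_false, if_false, add_zero]
    refine le_trans (Finset.sum_le_sum fun i _ => ?_) ih
    by_cases h1 : x.getD i false = true <;> by_cases h2 : z.Sublist (x.eraseIdx i)
    · rw [if_neg, if_neg]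
      · tauto
      · rintro ⟨_, h3⟩; exact h3 (h2.cons a)
    · rw [if_pos (show _ ∧ _ from ⟨h1, h2⟩)]
      split_ifs <;> norm_num
    · rw [if_neg (fun h => h1 h.1)]; split_ifs <;> norm_num
    · rw [if_neg (fun h => h1 h.1)]; split_ifs <;> norm_num
  | @cons_cons z x a h ih =>
    rw [List.length_cons, Finset.sum_range_succ']
    simp only [List.getD_cons_succ, List.getD_cons_zero, List.eraseIdx_cons_succ,
      List.eraseIdx_cons_zero, List.cons_sublist_cons]
    rw [List.count_cons]
    push_cast
    refine add_le_add ih ?_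
    cases a
    · simp
    · simp only [true_and]
      split_ifs <;> simp_all

theorem ess_lcs (x y z : List Bool) (hz : z.length = lcsLen x y) (hx : z.Sublist x)
    (hy : z.Sublist y) :
    ∑ i ∈ Finset.range x.length,
      (if x.getD i false = true then ((lcsLen x y : ℝ) - lcsLen (x.eraseIdx i) y) else 0)
      ≤ z.count true := by
  refine le_trans (Finset.sum_le_sum fun i hi => ?_) (ess_le hx)
  have hi : i < x.length := by simpa using hi
  by_cases h1 : x.getD i false = true
  · rw [if_pos h1]
    by_cases h2 : z.Sublist (x.eraseIdx i)
    · rw [if_neg (by tauto)]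
      have := le_lcs h2 hy
      rw [hz] at this
      have : (lcsLen x y : ℝ) ≤ lcsLen (x.eraseIdx i) y := by exact_mod_cast this
      linarith
    · rw [if_pos ⟨h1, h2⟩]
      have : lcsLen x y ≤ lcsLen (x.eraseIdx i) y + 1 := by
        clear h1 h2 hx hy hz
        obtain ⟨z, hz, h1, h2⟩ := lcs_ex x y
        rw [← hz]
        obtain ⟨w, hw1, hw2, hw3⟩ : ∃ w : List Bool, w.Sublist z ∧ w.Sublist (x.eraseIdx i)
            ∧ z.length ≤ w.length + 1 := by
          clear hz h2 y
          induction h1 generalizing i with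
          | slnil => simp at hi
          | @cons z x a h ih =>
            cases i with
            | zero => exact ⟨z, List.Sublist.refl _, by simpa using h, by omega⟩
            | succ i =>
              obtain ⟨w, a1, a2, a3⟩ := ih i (by simpa using hi) (by simpa using hi)
              exact ⟨w, a1, by simpa using a2.cons a, a3⟩
          | @cons_cons z x a h ih =>
            cases i with
            | zero => exact ⟨z, List.sublist_cons_self _ _, by simpa using h, by simp⟩
            | succ i =>
              obtain ⟨w, a1, a2, a3⟩ := ih i (by simpa using hi) (by simpa using hi)
              exact ⟨a :: w, a1.cons_cons a, by simpa using a2, by simpa using a3⟩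
        exact hw3.trans (Nat.succ_le_succ (le_lcs hw2 (hw1.trans h2)))
      have : (lcsLen x y : ℝ) ≤ lcsLen (x.eraseIdx i) y + 1 := by exact_mod_cast this
      linarith
  · rw [if_neg h1, if_neg (by tauto)]

/-! ### path-counting weight -/

/-- inner sum over the next matched one of `y` -/
def Inn (g : List Bool → ℝ) : ℤ → List Bool → ℝ
  | _, [] => 0
  | i, c :: y => (if c = true then (1/2 : ℝ) ^ i.natAbs * g y else 0) + Inn g (i - 1) y

/-- the weight -/
def W (s : ℝ) : List Bool → ℤ → List Bool → ℝ
  | [], _, _ => 1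
  | false :: x, i, y => W s x (i + 1) y
  | true :: x, i, y => W s x (i + 1) y + s * Inn (W s x 0) i y

theorem Inn_nonneg (g : List Bool → ℝ) (hg : ∀ y, 0 ≤ g y) (y : List Bool) :
    ∀ i, 0 ≤ Inn g i y := by
  induction y with
  | nil => intro i; simp [Inn]
  | cons c y ih =>
    intro i
    simp only [Inn]
    have := ih (i - 1)
    have := hg y
    split_ifs <;> positivity

theorem Inn_ge (g : List Bool → ℝ) (hg : ∀ y, 0 ≤ g y) (y w : List Bool) :
    ∀ i : ℤ, (1/2 : ℝ) ^ (i - w.length).natAbs * g y ≤ Inn g i (w ++ true :: y) := by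
  induction w with
  | nil =>
    intro i
    have := Inn_nonneg g hg y (i - 1)
    simp [Inn]
    simpa using this
  | cons c w ih =>
    intro i
    have h1 := ih (i - 1)
    have h2 := hg (w ++ true :: y)
    simp only [List.cons_append, Inn, List.length_cons]
    have e : i - ((w.length + 1 : ℕ) : ℤ) = i - 1 - w.length := by push_cast; ring
    rw [e]
    have : 0 ≤ (if c = true then (1/2 : ℝ) ^ i.natAbs * g (w ++ true :: y) else 0) := by
      split_ifs <;> positivity
    linarith

theorem W_one_le (s : ℝ) (hs : 0 ≤ s) (x : List Bool) : ∀ i y, 1 ≤ W s x i y := by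
  induction x with
  | nil => intro i y; simp [W]
  | cons c x ih =>
    intro i y
    cases c
    · simpa [W] using ih (i + 1) y
    · simp only [W]
      have := Inn_nonneg (W s x 0) (fun y => le_trans zero_le_one (ih 0 y)) y i
      have := ih (i + 1) y
      nlinarith [mul_nonneg hs (Inn_nonneg (W s x 0) (fun y => le_trans zero_le_one (ih 0 y)) y i)]

theorem W_skip (s : ℝ) (hs : 0 ≤ s) (c : Bool) (x : List Bool) (i : ℤ) (y : List Bool) :
    W s x (i + 1) y ≤ W s (c :: x) i y := by
  cases c
  · simp [W]
  · simp only [W]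
    have := mul_nonneg hs (Inn_nonneg (W s x 0)
      (fun y => le_trans zero_le_one (W_one_le s hs x 0 y)) y i)
    linarith

theorem half_pow_le {m n : ℕ} (h : m ≤ n) : (1/2 : ℝ) ^ n ≤ (1/2 : ℝ) ^ m :=
  pow_le_pow_of_le_one (by norm_num) (by norm_num) h

theorem W_ge (s : ℝ) (hs : 0 ≤ s) {z x : List Bool} (hx : z.Sublist x) :
    ∀ (y w : List Bool) (i : ℤ) (e : ℕ), z.Sublist y → x.length + y.length = 2 * z.length + e →
      s ^ (z.count true) * (1/2 : ℝ) ^ (e + (i - w.length).natAbs) ≤ W s x i (w ++ y) := by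
  induction hx with
  | slnil =>
    intro y w i e _ _
    simp only [W, List.count_nil, pow_zero, one_mul]
    exact pow_le_one₀ (by norm_num) (by norm_num)
  | @cons z x a h ih =>
    intro y w i e hy he
    have hle := h.length_le
    have hle2 := hy.length_le
    obtain ⟨e, rfl⟩ : ∃ e', e = e' + 1 := ⟨e - 1, by simp at he; omega⟩
    refine le_trans ?_ ((ih y w (i + 1) e hy (by simp at he; omega)).trans (W_skip s hs a x i _))
    exact mul_le_mul_of_nonneg_left (half_pow_le (by omega)) (pow_nonneg hs _)
  | @cons_cons z x a h ih =>
    intro y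
    induction y with
    | nil => intro w i e hy; simp at hy
    | cons c y ihy =>
      intro w i e hy he
      have hle := h.length_le
      rcases List.sublist_cons_iff.1 hy with h' | ⟨r, hr, h'⟩
      · have hle2 := h'.length_le
        obtain ⟨e, rfl⟩ : ∃ e', e = e' + 1 := ⟨e - 1, by simp at he hle2; omega⟩
        have := ihy (w ++ [c]) i e h' (by simp at he ⊢; omega)
        rw [List.append_assoc, List.singleton_append] at this
        refine le_trans ?_ this
        refine mul_le_mul_of_nonneg_left (half_pow_le ?_) (pow_nonneg hs _)
        simp only [List.length_append, List.length_singleton]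
        omega
      · obtain ⟨rfl, rfl⟩ : a = c ∧ z = r := by simpa using hr
        cases a
        · have := ih y (w ++ [false]) (i + 1) e h' (by simp at he; omega)
          rw [List.append_assoc, List.singleton_append] at this
          simp only [W]
          refine le_trans ?_ this
          rw [List.count_cons_of_ne (by simp)]
          refine mul_le_mul_of_nonneg_left (half_pow_le ?_) (pow_nonneg hs _)
          simp only [List.length_append, List.length_singleton]
          omega
        · have h1 := ih y [] 0 e h' (by simp at he; omega)
          simp only [List.length_nil, List.nil_append, Nat.cast_zero, sub_zero, Int.natAbs_zero,
            add_zero] at h1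
          have hg : ∀ y, 0 ≤ W s x 0 y := fun y => le_trans zero_le_one (W_one_le s hs x 0 y)
          have h2 := Inn_ge (W s x 0) hg y w i
          have h3 := W_one_le s hs x (i + 1) (w ++ true :: y)
          simp only [W, List.count_cons_self]
          calc s ^ (z.count true + 1) * (1/2 : ℝ) ^ (e + (i - w.length).natAbs)
              = s * ((1/2 : ℝ) ^ (i - w.length).natAbs * (s ^ z.count true * (1/2 : ℝ) ^ e)) := by
                rw [pow_add, pow_add]; ring
            _ ≤ s * ((1/2 : ℝ) ^ (i - w.length).natAbs * W s x 0 y) := by gcongr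
            _ ≤ s * Inn (W s x 0) i (w ++ true :: y) := by gcongr
            _ ≤ _ := by linarith

/-- bound for the two-sided geometric sum -/
def tau (i : ℤ) : ℝ := if i ≤ 0 then 2 * (1/2 : ℝ) ^ i.natAbs else 3 - (1/2 : ℝ) ^ i.natAbs

theorem tau_nonneg (i : ℤ) : 0 ≤ tau i := by
  unfold tau
  have : (1/2 : ℝ) ^ i.natAbs ≤ 1 := pow_le_one₀ (by norm_num) (by norm_num)
  split_ifs
  · positivity
  · linarith

theorem tau_le (i : ℤ) : tau i ≤ 3 := by
  unfold tau
  have : (1/2 : ℝ) ^ i.natAbs ≤ 1 := pow_le_one₀ (by norm_num) (by norm_num)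
  have : 0 ≤ (1/2 : ℝ) ^ i.natAbs := by positivity
  split_ifs <;> linarith

theorem tau_step (i : ℤ) : (1/2 : ℝ) ^ i.natAbs + tau (i - 1) ≤ tau i := by
  unfold tau
  rcases lt_trichotomy i 0 with h | h | h
  · rw [if_pos (by omega), if_pos (by omega)]
    rw [show (i - 1).natAbs = i.natAbs + 1 by omega, pow_succ]
    linarith
  · subst h; norm_num
  · rw [if_neg (show ¬ i ≤ 0 by omega)]
    obtain ⟨m, rfl⟩ : ∃ m : ℕ, i = m + 1 := ⟨(i - 1).toNat, by omega⟩
    rw [show ((m : ℤ) + 1).natAbs = m + 1 by omega, show (m : ℤ) + 1 - 1 = m by ring]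
    rcases Nat.eq_zero_or_pos m with rfl | hm
    · norm_num
    · rw [if_neg (by omega), Int.natAbs_natCast, pow_succ]
      linarith

theorem Ex_Inn (ε : ℝ) (h0 : 0 ≤ ε) (h1 : ε ≤ 1) (g : List Bool → ℝ) (G : ℝ) (hG : 0 ≤ G)
    (hg : ∀ b, Ex ε b g ≤ G) : ∀ (b : ℕ) (i : ℤ), Ex ε b (Inn g i) ≤ ε * G * tau i := by
  intro b
  induction b with
  | zero =>
    intro i
    simp only [Ex, Inn]
    exact mul_nonneg (mul_nonneg h0 hG) (tau_nonneg i)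
  | succ b ih =>
    intro i
    simp only [Ex, Inn, Ex_add, Ex_mul, if_true]
    simp only [Bool.false_eq_true, if_false, Ex_const]
    have a1 := ih (i - 1)
    have a2 := mul_le_mul_of_nonneg_left (hg b) (mul_nonneg h0 (by positivity : (0:ℝ) ≤ (1/2) ^ i.natAbs))
    have a3 := mul_le_mul_of_nonneg_left (tau_step i) (mul_nonneg h0 hG)
    have e : Ex ε b (fun l => Inn g (i - 1) l) = Ex ε b (Inn g (i - 1)) := rfl
    have e2 : Ex ε b (fun l => g l) = Ex ε b g := rfl
    rw [e]
    nlinarith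

theorem Ex_W (ε s : ℝ) (h0 : 0 ≤ ε) (h1 : ε ≤ 1) (hs : 0 ≤ s) (hse : 3 * s * ε ≤ 1)
    (x : List Bool) : ∀ (i : ℤ) (b : ℕ), Ex ε b (W s x i) ≤ 2 ^ (x.count true) := by
  induction x with
  | nil => intro i b; simp [W, Ex_const]
  | cons c x ih =>
    intro i b
    cases c
    · have := ih (i + 1) b
      rw [List.count_cons_of_ne (by simp)]
      exact this
    · have a1 := ih (i + 1) b
      have a2 := Ex_Inn ε h0 h1 (W s x 0) (2 ^ (x.count true)) (by positivity) (ih 0) b i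
      have e : Ex ε b (W s (true :: x) i) = Ex ε b (W s x (i + 1)) + s * Ex ε b (Inn (W s x 0) i) := by
        rw [← Ex_mul, ← Ex_add]; rfl
      rw [e, List.count_cons_self, pow_succ]
      set G : ℝ := 2 ^ (x.count true)
      have hG : 0 ≤ G := by positivity
      have a3 := mul_le_mul_of_nonneg_left a2 hs
      have a4 := mul_le_mul_of_nonneg_left (tau_le i) (mul_nonneg hs (mul_nonneg h0 hG))
      have a5 := mul_le_mul_of_nonneg_right hse hG
      nlinarith

/-- a chosen optimal common subsequence -/
def opt (x y : List Bool) : List Bool := (lcs_ex x y).choose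

theorem opt_spec (x y : List Bool) : (opt x y).length = lcsLen x y ∧ (opt x y).Sublist x ∧
    (opt x y).Sublist y := (lcs_ex x y).choose_spec

/-- expected number of matched ones -/
theorem opt_count (ε : ℝ) (h0 : 0 < ε) (h1 : ε < 1 / 100000) (a b : ℕ) :
    15 * E2 ε a b (fun x y => ((opt x y).count true : ℝ)) ≤ (a + b - 2 * mL ε a b) + ε * a := by
  have hl2 : 0 < Real.log 2 := Real.log_pos (by norm_num)
  set s : ℝ := 2 ^ 15 with hs
  have hs0 : (0:ℝ) ≤ s := by positivity
  have h1' : ε ≤ 1 := by linarith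
  have hse : 3 * s * ε ≤ 1 := by rw [hs]; nlinarith
  have key : ∀ x y : List Bool, x.length = a → y.length = b →
      15 * ((opt x y).count true : ℝ) * Real.log 2
        ≤ (((2 ^ (x.count true) : ℝ)⁻¹ * W s x 0 y + -1) + Real.log 2 * (x.count true : ℝ))
          + Real.log 2 * ((a + b) + (-2) * (lcsLen x y : ℝ)) := by
    intro x y hxa hyb
    obtain ⟨hz, hx, hy⟩ := opt_spec x y
    set z := opt x y
    have l1 := hx.length_le
    have l2 := hy.length_le
    have := W_ge s hs0 hx y [] 0 (x.length + y.length - 2 * z.length) hy (by omega)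
    simp only [List.length_nil, List.nil_append, Nat.cast_zero, sub_zero, Int.natAbs_zero,
            add_zero] at this
    have hpos : 0 < s ^ (z.count true) * (1/2 : ℝ) ^ (x.length + y.length - 2 * z.length) := by
      positivity
    have hlog := Real.log_le_log hpos this
    rw [Real.log_mul (by positivity) (by positivity), Real.log_pow, Real.log_pow, hs, Real.log_pow,
      one_div, Real.log_inv, Nat.cast_sub (by omega), ← hs] at hlog
    push_cast at hlog
    rw [hxa, hyb, hz] at hlog
    have hW : 0 < W s x 0 y := lt_of_lt_of_le zero_lt_one (W_one_le s hs0 x 0 y)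
    have h2 : (0:ℝ) < (2 ^ (x.count true) : ℝ)⁻¹ := by positivity
    have ht := Real.log_le_sub_one_of_pos (mul_pos h2 hW)
    rw [Real.log_mul h2.ne' hW.ne', Real.log_inv, Real.log_pow] at ht
    generalize (2 ^ (x.count true) : ℝ)⁻¹ * W s x 0 y = q at ht ⊢
    generalize Real.log (W s x 0 y) = r at ht hlog
    clear hpos this hse
    linarith
  have h := E2_mono ε h0.le h1' a b _ _ key
  have e1 : E2 ε a b (fun x y => 15 * ((opt x y).count true : ℝ) * Real.log 2)
      = (15 * Real.log 2) * E2 ε a b (fun x y => ((opt x y).count true : ℝ)) := by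
    rw [← E2_mul]; congr 1; ext x y; ring
  have e3 : E2 ε a b (fun x _ => (x.count true : ℝ)) = ε * a := by
    simp only [E2, Ex_const, Ex_count]
  have e4 : E2 ε a b (fun x y => (2 ^ (x.count true) : ℝ)⁻¹ * W s x 0 y) ≤ 1 := by
    have : E2 ε a b (fun x y => (2 ^ (x.count true) : ℝ)⁻¹ * W s x 0 y) ≤ Ex ε a (fun _ => 1) := by
      refine Ex_mono ε h0.le h1' _ _ _ fun x _ => ?_
      rw [Ex_mul, inv_mul_le_iff₀ (by positivity), mul_one]
      exact Ex_W ε s h0.le h1' hs0 hse x 0 b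
    rwa [Ex_const] at this
  rw [e1, E2_add, E2_add, E2_add, E2_mul ε a b (Real.log 2), E2_mul ε a b (Real.log 2),
    E2_add, E2_mul ε a b (-2), E2_const, E2_const, e3] at h
  change _ ≤ _ + Real.log 2 * (_ + -2 * mL ε a b) at h
  have : Real.log 2 * (15 * E2 ε a b (fun x y => ((opt x y).count true : ℝ)))
      ≤ Real.log 2 * ((a + b - 2 * mL ε a b) + ε * a) := by nlinarith
  exact le_of_mul_le_mul_left this hl2

/-- covariance bound -/
theorem cov_bound (ε : ℝ) (h0 : 0 < ε) (h1 : ε < 1 / 100000) (n b : ℕ) :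
    15 * (E2 ε (n+1) b (fun x y => (x.count true : ℝ) * (lcsLen x y : ℝ))
      - (n+1) * (ε * mL ε n b)) ≤ ((n + 1) + b - 2 * mL ε (n+1) b) + ε * (n+1) := by
  have h1' : ε ≤ 1 := by linarith
  have h := opt_count ε h0 h1 (n+1) b
  push_cast at h
  refine le_trans (mul_le_mul_of_nonneg_left ?_ (by norm_num)) h
  have key : E2 ε (n+1) b (fun x y => ∑ i ∈ Finset.range (n+1),
      (if x.getD i false = true then ((lcsLen x y : ℝ) - lcsLen (x.eraseIdx i) y) else 0))
      ≤ E2 ε (n+1) b (fun x y => ((opt x y).count true : ℝ)) := by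
    refine E2_mono ε h0.le h1' _ _ _ _ fun x y hx _ => ?_
    obtain ⟨a1, a2, a3⟩ := opt_spec x y
    have := ess_lcs x y _ a1 a2 a3
    rwa [hx] at this
  refine le_trans (le_of_eq ?_) key
  have e : E2 ε (n+1) b (fun x y => ∑ i ∈ Finset.range (n+1),
      (if x.getD i false = true then ((lcsLen x y : ℝ) - lcsLen (x.eraseIdx i) y) else 0))
      = E2 ε (n+1) b (fun x y => (x.count true : ℝ) * (lcsLen x y : ℝ) +
        (-1) * ∑ i ∈ Finset.range (n+1),
          (if x.getD i false = true then (lcsLen (x.eraseIdx i) y : ℝ) else 0)) := by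
    refine E2_congr ε _ _ _ _ fun x y hx _ => ?_
    rw [← count_eq_sum, hx, neg_one_mul, ← sub_eq_add_neg, ← Finset.sum_sub_distrib]
    refine Finset.sum_congr rfl fun i _ => ?_
    split_ifs <;> simp
  rw [e, E2_add, E2_mul]
  have e2 : E2 ε (n+1) b (fun x y => ∑ i ∈ Finset.range (n+1),
          (if x.getD i false = true then (lcsLen (x.eraseIdx i) y : ℝ) else 0))
          = (n+1) * (ε * mL ε n b) := by
    have : ∀ i ∈ Finset.range (n+1), E2 ε (n+1) b (fun x y =>
        (if x.getD i false = true then (lcsLen (x.eraseIdx i) y : ℝ) else 0)) = ε * mL ε n b := by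
      intro i hi
      have hi : i ≤ n := by simp at hi; omega
      unfold mL E2
      rw [← Ex_erase ε n i _ hi]
      congr 1
      ext x
      by_cases hx : x.getD i false = true
      · simp only [hx, if_true]
      · simp only [hx, Bool.false_eq_true, if_false, Ex_const]
    calc _ = ∑ i ∈ Finset.range (n+1), E2 ε (n+1) b (fun x y =>
        (if x.getD i false = true then (lcsLen (x.eraseIdx i) y : ℝ) else 0)) := by
          simp only [E2, Ex_sum]
      _ = _ := by
          rw [Finset.sum_congr rfl this]; simp
  rw [e2]; ring

/-- second moment around any constant is linear -/
theorem second_moment (ε : ℝ) (h0 : 0 < ε) (h1 : ε < 1 / 100000) (n b : ℕ) (hb : b ≤ n + 1)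
    (hn : 1 ≤ ε * n) (hm : (1 - 2 * ε) * n ≤ mL ε (n+1) b)
    (hm2 : b = n + 1 → (1 - 2 * ε) * (n + 1) ≤ mL ε (n+1) b)
    (hb2 : b = n ∨ b = n + 1)
    (hinc : (1 - 2 * ε) / 2 ≤ mL ε (n+1) b - mL ε n b) (c : ℝ) :
    0.008 * ε * (n+1) ≤ E2 ε (n+1) b (fun x y => ((lcsLen x y : ℝ) - c) ^ 2) := by
  have h1' : ε ≤ 1 := by linarith
  have hc := cov_bound ε h0 h1 n b
  set M := E2 ε (n+1) b (fun x y => (x.count true : ℝ) * (lcsLen x y : ℝ)) with hM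
  set f := mL ε (n+1) b with hf
  have hn0 : (0:ℝ) ≤ n := Nat.cast_nonneg n
  have hgap : ((n:ℝ) + 1) + b - 2 * f ≤ 5 * ε * (n+1) := by
    rcases hb2 with rfl | rfl
    · nlinarith
    · have := hm2 rfl
      push_cast
      nlinarith
  have hcov : M - ε * (n+1) * f ≤ - (0.09 * (ε * (n+1))) := by
    have hp : 0 ≤ ε * ((n:ℝ)+1) := by positivity
    have := mul_le_mul_of_nonneg_left hinc hp
    nlinarith
  set V := E2 ε (n+1) b (fun x y => ((lcsLen x y : ℝ) - c) ^ 2) with hV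
  have hpos : 0 ≤ E2 ε (n+1) b (fun x y =>
      (((lcsLen x y : ℝ) - c) + 0.09 * ((x.count true : ℝ) - ε * (n+1))) ^ 2) := by
    have := E2_mono ε h0.le h1' (n+1) b (fun _ _ => 0) (fun x y =>
      (((lcsLen x y : ℝ) - c) + 0.09 * ((x.count true : ℝ) - ε * (n+1))) ^ 2)
      (fun x y _ _ => sq_nonneg _)
    rwa [E2_const] at this
  have hexp : E2 ε (n+1) b (fun x y =>
      (((lcsLen x y : ℝ) - c) + 0.09 * ((x.count true : ℝ) - ε * (n+1))) ^ 2)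
      = V + 0.18 * (M - ε * (n+1) * f) + 0.0081 * ((n+1) * ε * (1-ε)) := by
    have e3 : E2 ε (n+1) b (fun x _ => (x.count true : ℝ)) = ε * (n+1) := by
      simp only [E2, Ex_const, Ex_count]; push_cast; ring
    have e4 : E2 ε (n+1) b (fun x _ => (x.count true : ℝ)^2)
        = (ε * (n+1))^2 + (n+1) * ε * (1-ε) := by
      simp only [E2, Ex_const, Ex_count_sq]; push_cast; ring
    have : (fun x y : List Bool =>
      (((lcsLen x y : ℝ) - c) + 0.09 * ((x.count true : ℝ) - ε * (n+1))) ^ 2)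
      = (fun x y : List Bool => ((lcsLen x y : ℝ) - c) ^ 2
        + (0.18 * ((x.count true : ℝ) * (lcsLen x y : ℝ))
        + ((- 0.18 * ε * (n+1)) * (lcsLen x y : ℝ)
        + ((- 0.18 * c - 0.0162 * ε * (n+1)) * (x.count true : ℝ)
        + (0.0081 * (x.count true : ℝ) ^ 2
        + (0.18 * c * (ε * (n+1)) + 0.0081 * (ε * (n+1))^2)))))) := by
      ext x y; ring
    rw [this, E2_add, E2_add, E2_add, E2_add, E2_add, E2_mul, E2_mul, E2_mul, E2_mul, E2_const,
      e3, e4]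
    change V + (0.18 * M + (_ * f + _)) = _
    ring
  rw [hexp] at hpos
  have hp : 0 ≤ ε * ((n:ℝ)+1) := by positivity
  have : ((n:ℝ)+1) * ε * (1-ε) ≤ ε * (n+1) := by nlinarith
  nlinarith

theorem varL_eq (ε : ℝ) (n : ℕ) :
    varL ε n = E2 ε n n (fun x y => ((lcsLen x y : ℝ) - mL ε n n) ^ 2) := by
  have e1 : varL ε n = E2 ε n n (fun x y => (lcsLen x y : ℝ) ^ 2) - (mL ε n n) ^ 2 := by
    unfold varL mL
    rw [← expec_eq_E2, ← expec_eq_E2]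
    rfl
  have : (fun x y : List Bool => ((lcsLen x y : ℝ) - mL ε n n) ^ 2)
    = (fun x y : List Bool => (lcsLen x y : ℝ) ^ 2 + ((-2 * mL ε n n) * (lcsLen x y : ℝ)
      + (mL ε n n) ^ 2)) := by
    ext x y; ring
  rw [e1, this, E2_add, E2_add, E2_mul, E2_const]
  change _ = _ + (_ * mL ε n n + _)
  ring

theorem sq_aux (u v c : ℝ) (h : u ≤ v) (h2 : v ≤ u + 2) :
    (v - c) ^ 2 ≤ 2 * (u - c) ^ 2 + 8 := by
  nlinarith [sq_nonneg (u - c - (v - u)), mul_nonneg (sub_nonneg.2 h) (sub_nonneg.2 h2)]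

theorem var_transfer (ε : ℝ) (h0 : 0 ≤ ε) (h1 : ε ≤ 1) (n b : ℕ) (hb : b = n ∨ b = n + 1)
    (c : ℝ) :
    E2 ε (n+1) b (fun x y => ((lcsLen x y : ℝ) - c) ^ 2)
      ≤ 2 * E2 ε n n (fun x y => ((lcsLen x y : ℝ) - c) ^ 2) + 8 := by
  set V := E2 ε n n (fun x y => ((lcsLen x y : ℝ) - c) ^ 2) with hV
  have hR : 2 * V + 8 = E2 ε n n (fun x y => 2 * ((lcsLen x y : ℝ) - c) ^ 2 + 8) := by
    rw [E2_add, E2_mul, E2_const]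
  have h1' : 0 ≤ 1 - ε := by linarith
  rcases hb with rfl | rfl
  · have hh : ∀ d : Bool, E2 ε b b (fun x y => ((lcsLen (d :: x) y : ℝ) - c) ^ 2) ≤ 2 * V + 8 := by
      intro d
      rw [hR]
      refine E2_mono ε h0 h1 _ _ _ _ fun x y _ _ => sq_aux _ _ _ ?_ ?_
      · exact_mod_cast lcs_mono (List.sublist_cons_self _ _) (List.Sublist.refl _)
      · exact_mod_cast (lcs_cons_le d x y).trans (by omega)
    have e : E2 ε (b+1) b (fun x y => ((lcsLen x y : ℝ) - c) ^ 2)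
      = (1 - ε) * E2 ε b b (fun x y => ((lcsLen (false :: x) y : ℝ) - c) ^ 2)
      + ε * E2 ε b b (fun x y => ((lcsLen (true :: x) y : ℝ) - c) ^ 2) := rfl
    have b1 := mul_le_mul_of_nonneg_left (hh false) h1'
    have b2 := mul_le_mul_of_nonneg_left (hh true) h0
    rw [e]; linarith
  · have hh : ∀ d d' : Bool,
        E2 ε n n (fun x y => ((lcsLen (d :: x) (d' :: y) : ℝ) - c) ^ 2) ≤ 2 * V + 8 := by
      intro d d'
      rw [hR]
      refine E2_mono ε h0 h1 _ _ _ _ fun x y _ _ => sq_aux _ _ _ ?_ ?_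
      · exact_mod_cast lcs_mono (List.sublist_cons_self _ _) (List.sublist_cons_self _ _)
      · have a1 := lcs_cons_le d x (d' :: y)
        have a2 := lcs_cons_le' d' x y
        exact_mod_cast (show lcsLen (d :: x) (d' :: y) ≤ lcsLen x y + 2 by omega)
    rw [E2_succ_succ]
    have b1 := mul_le_mul_of_nonneg_left (hh false false) (mul_nonneg h1' h1')
    have b2 := mul_le_mul_of_nonneg_left (hh false true) (mul_nonneg h1' h0)
    have b3 := mul_le_mul_of_nonneg_left (hh true false) (mul_nonneg h0 h1')
    have b4 := mul_le_mul_of_nonneg_left (hh true true) (mul_nonneg h0 h0)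
    nlinarith

theorem varL_large (ε : ℝ) (h0 : 0 < ε) (h1 : ε < 1 / 100000) (n : ℕ) (hn : 4000 ≤ ε * n) :
    0.002 * ε * n ≤ varL ε n := by
  have h1' : ε ≤ 1 := by linarith
  rw [varL_eq]
  set c := mL ε n n with hc
  have a1 := mL_succ_succ ε h0.le h1' n
  have a2 := mL_diag ε h0.le h1' n
  have a3 := mL_diag ε h0.le h1' (n+1)
  have a4 := mL_mono ε h0.le h1' n n
  have a5 := mL_comm ε n (n+1)
  push_cast at a3
  by_cases hcase : (1 - 2 * ε) / 2 ≤ mL ε (n+1) n - mL ε n n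
  · have hsm := second_moment ε h0 h1 n n (by omega) (by linarith) (by linarith) (by omega)
      (Or.inl rfl) hcase c
    have := var_transfer ε h0.le h1' n n (Or.inl rfl) c
    nlinarith
  · have hsm := second_moment ε h0 h1 n (n+1) (by omega) (by linarith) (by nlinarith)
      (fun _ => a3) (Or.inr rfl) (by linarith) c
    have := var_transfer ε h0.le h1' n (n+1) (Or.inr rfl) c
    nlinarith

theorem Ex_ge_false (ε : ℝ) (h0 : 0 ≤ ε) (h1 : ε ≤ 1) : ∀ (n : ℕ) (h : List Bool → ℝ),
    (∀ l, 0 ≤ h l) → (1 - ε) ^ n * h (List.replicate n false) ≤ Ex ε n h := by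
  intro n
  induction n with
  | zero => intro h _; simp [Ex]
  | succ n ih =>
    intro h hh
    have h1' : 0 ≤ 1 - ε := by linarith
    have a1 := mul_le_mul_of_nonneg_left (ih (fun l => h (false :: l)) fun l => hh _) h1'
    have a2 : 0 ≤ Ex ε n (fun l => h (true :: l)) := by
      have := Ex_mono ε h0 h1 n (fun _ => 0) (fun l => h (true :: l)) (fun l _ => hh _)
      rwa [Ex_const] at this
    have a3 := mul_nonneg h0 a2
    rw [Ex, List.replicate_succ, pow_succ]
    nlinarith

theorem Ex_ge_true (ε : ℝ) (h0 : 0 ≤ ε) (h1 : ε ≤ 1) : ∀ (n : ℕ) (h : List Bool → ℝ),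
    (∀ l, 0 ≤ h l) → ε ^ n * h (List.replicate n true) ≤ Ex ε n h := by
  intro n
  induction n with
  | zero => intro h _; simp [Ex]
  | succ n ih =>
    intro h hh
    have h1' : 0 ≤ 1 - ε := by linarith
    have a1 := mul_le_mul_of_nonneg_left (ih (fun l => h (true :: l)) fun l => hh _) h0
    have a2 : 0 ≤ Ex ε n (fun l => h (false :: l)) := by
      have := Ex_mono ε h0 h1 n (fun _ => 0) (fun l => h (false :: l)) (fun l _ => hh _)
      rwa [Ex_const] at this
    have a3 := mul_nonneg h1' a2
    rw [Ex, List.replicate_succ, pow_succ]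
    nlinarith

theorem Ex_nonneg (ε : ℝ) (h0 : 0 ≤ ε) (h1 : ε ≤ 1) (n : ℕ) (h : List Bool → ℝ)
    (hh : ∀ l, 0 ≤ h l) : 0 ≤ Ex ε n h := by
  have := Ex_mono ε h0 h1 n (fun _ => 0) h (fun l _ => hh _)
  rwa [Ex_const] at this

theorem varL_pos (ε : ℝ) (h0 : 0 < ε) (h1 : ε < 1) (n : ℕ) (hn : 1 ≤ n) : 0 < varL ε n := by
  rw [varL_eq]
  set c := mL ε n n with hc
  have hp : 0 < 1 - ε := by linarith
  have k1 : lcsLen (List.replicate n false) (List.replicate n false) = n := by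
    apply le_antisymm
    · obtain ⟨z, hz, h, _⟩ := lcs_ex (List.replicate n false) (List.replicate n false)
      rw [← hz]; simpa using h.length_le
    · simpa using le_lcs (List.Sublist.refl (List.replicate n false)) (List.Sublist.refl _)
  have k2 : lcsLen (List.replicate n false) (List.replicate n true) = 0 := by
    obtain ⟨z, hz, h, h'⟩ := lcs_ex (List.replicate n false) (List.replicate n true)
    rw [← hz]
    cases z with
    | nil => rfl
    | cons d z =>
      have m1 := List.eq_of_mem_replicate (h.subset (List.mem_cons_self))
      have m2 := List.eq_of_mem_replicate (h'.subset (List.mem_cons_self))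
      rw [m1] at m2; simp at m2
  have A := Ex_ge_false ε h0.le h1.le n
    (fun x => Ex ε n (fun y => ((lcsLen x y : ℝ) - c) ^ 2))
    (fun x => Ex_nonneg ε h0.le h1.le _ _ fun y => sq_nonneg _)
  have B := Ex_ge_false ε h0.le h1.le n
    (fun y => ((lcsLen (List.replicate n false) y : ℝ) - c) ^ 2) (fun y => sq_nonneg _)
  have C := Ex_ge_true ε h0.le h1.le n
    (fun y => ((lcsLen (List.replicate n false) y : ℝ) - c) ^ 2) (fun y => sq_nonneg _)
  simp only [k1] at B
  simp only [k2] at C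
  change _ ≤ E2 ε n n _ at A
  refine lt_of_lt_of_le (mul_pos (pow_pos hp n) ?_) A
  by_cases hz : c = 0
  · refine lt_of_lt_of_le (mul_pos (pow_pos hp n) ?_) B
    rw [hz]
    have : (0:ℝ) < n := by exact_mod_cast hn
    rw [sub_zero]
    positivity
  · refine lt_of_lt_of_le (mul_pos (pow_pos h0 n) ?_) C
    have : (((0:ℕ):ℝ) - c) ≠ 0 := by simpa using hz
    positivity

theorem small_n (ε : ℝ) (h0 : 0 < ε) (h1 : ε < 1) (N : ℕ) :
    ∃ c : ℝ, 0 < c ∧ ∀ n : ℕ, 1 ≤ n → n ≤ N → c * n ≤ varL ε n := by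
  induction N with
  | zero => exact ⟨1, one_pos, fun n a b => by omega⟩
  | succ N ih =>
    obtain ⟨c, hc, h⟩ := ih
    have hv := varL_pos ε h0 h1 (N+1) (by omega)
    have hN : (0:ℝ) < ((N+1 : ℕ) : ℝ) := by positivity
    refine ⟨min c (varL ε (N+1) / ((N+1 : ℕ) : ℝ)), lt_min hc (div_pos hv hN), ?_⟩
    intro n a b
    rcases Nat.lt_or_ge N n with h' | h'
    · obtain rfl : n = N + 1 := by omega
      calc _ ≤ varL ε (N+1) / ((N+1 : ℕ) : ℝ) * ((N+1 : ℕ) : ℝ) :=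
            mul_le_mul_of_nonneg_right (min_le_right _ _) hN.le
        _ = _ := div_mul_cancel₀ _ hN.ne'
    · exact le_trans (mul_le_mul_of_nonneg_right (min_le_left _ _) (Nat.cast_nonneg n)) (h n a h')

/-- There exists ε₀ > 0 such that for every ε ∈ (0, ε₀) there exists a constant c > 0,
depending on ε but not on n, such that Var[L_n] ≥ c·n for all n ≥ 1. -/
theorem stmt0 :
    ∃ ε₀ : ℝ, 0 < ε₀ ∧ ε₀ ≤ 1 / 2 ∧
      ∀ ε : ℝ, 0 < ε → ε < ε₀ →
        ∃ c : ℝ, 0 < c ∧ ∀ n : ℕ, 1 ≤ n → c * n ≤ varL ε n := by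
  refine ⟨1 / 100000, by norm_num, by norm_num, fun ε h0 h1 => ?_⟩
  obtain ⟨N, hN⟩ := exists_nat_gt (4000 / ε)
  obtain ⟨c, hc, h⟩ := small_n ε h0 (by linarith) N
  refine ⟨min c (0.002 * ε), lt_min hc (by positivity), fun n hn => ?_⟩
  rcases le_total n N with h' | h'
  · exact le_trans (mul_le_mul_of_nonneg_right (min_le_left _ _) (Nat.cast_nonneg n)) (h n hn h')
  · refine le_trans (mul_le_mul_of_nonneg_right (min_le_right _ _) (Nat.cast_nonneg n))
      (varL_large ε h0 h1 n ?_)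
    have h2 : (N : ℝ) ≤ n := by exact_mod_cast h'
    have h3 : 4000 / ε ≤ n := hN.le.trans h2
    rw [div_le_iff₀ h0] at h3
    linarith
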